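/- arXiv:0909.0319 — 2 statements merged into one kernel-verified Lean document; each statement's English description precedes it below -/
import Mathlib

section
/- Let 𝒜^s = 𝒢⊕F be the standard quadratic Lie algebroid determined by a quadruple (F,𝒢;∇,R) satisfying conditions (i)-(iv), let ℋ ∈ Γ(∧³F*), and define C^s ∈ Γ(∧³(𝒜^s)*) by C^s(r+x,s+y,t+z) = ℋ(x,y,z) − ⟨[r,s]_𝒢,t⟩_𝒢 + ⟨R(x,y),t⟩_𝒢 + ⟨R(y,z),r⟩_𝒢 + ⟨R(z,x),s⟩_𝒢. Then the following are equivalent: (a) d^Fℋ = ⟨R∧R⟩; (b) C^s is closed for the Lie algebroid differential of 𝒜^s; (c) C^s is a coherent 3-form on 𝒜^s. -/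
/-! # Statement 12
On the standard quadratic Lie algebroid `𝒜^s = 𝒢⊕F` determined by a quadruple
`(F,𝒢;∇,R)` satisfying (i)-(iv), and given `ℋ ∈ Γ(∧³F*)`, the 3-form
`C^s(r+x,s+y,t+z) = ℋ(x,y,z) − ⟨[r,s]_𝒢,t⟩_𝒢 + ⟨R(x,y),t⟩_𝒢 + ⟨R(y,z),r⟩_𝒢 + ⟨R(z,x),s⟩_𝒢`
satisfies: `d^Fℋ = ⟨R∧R⟩` ⟺ `C^s` closed ⟺ `C^s` coherent.

Algebraic model: `A` plays the role of `C^∞(M)`, vector fields are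
`Derivation ℝ A A`, and `F` is a bracket-closed `A`-submodule of
`Derivation ℝ A A`. -/

section CE
variable {V A : Type} [CommRing A]

/-- differential of a `1`-form -/
def dCE1 (act : V → A → A) (bk : V → V → V) (ω : V → A) (x₀ x₁ : V) : A :=
  act x₀ (ω x₁) - act x₁ (ω x₀) - ω (bk x₀ x₁)

/-- differential of a `2`-form -/
def dCE2 (act : V → A → A) (bk : V → V → V) (ω : V → V → A) (x₀ x₁ x₂ : V) : A :=
  act x₀ (ω x₁ x₂) - act x₁ (ω x₀ x₂) + act x₂ (ω x₀ x₁)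
    - ω (bk x₀ x₁) x₂ + ω (bk x₀ x₂) x₁ - ω (bk x₁ x₂) x₀

/-- differential of a `3`-form -/
def dCE3 (act : V → A → A) (bk : V → V → V) (ω : V → V → V → A)
    (x₀ x₁ x₂ x₃ : V) : A :=
  act x₀ (ω x₁ x₂ x₃) - act x₁ (ω x₀ x₂ x₃) + act x₂ (ω x₀ x₁ x₃)
    - act x₃ (ω x₀ x₁ x₂)
    - ω (bk x₀ x₁) x₂ x₃ + ω (bk x₀ x₂) x₁ x₃ - ω (bk x₀ x₃) x₁ x₂
    - ω (bk x₁ x₂) x₀ x₃ + ω (bk x₁ x₃) x₀ x₂ - ω (bk x₂ x₃) x₀ x₁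

/-- differential of a `4`-form -/
def dCE4 (act : V → A → A) (bk : V → V → V) (ω : V → V → V → V → A)
    (x₀ x₁ x₂ x₃ x₄ : V) : A :=
  act x₀ (ω x₁ x₂ x₃ x₄) - act x₁ (ω x₀ x₂ x₃ x₄) + act x₂ (ω x₀ x₁ x₃ x₄)
    - act x₃ (ω x₀ x₁ x₂ x₄) + act x₄ (ω x₀ x₁ x₂ x₃)
    - ω (bk x₀ x₁) x₂ x₃ x₄ + ω (bk x₀ x₂) x₁ x₃ x₄ - ω (bk x₀ x₃) x₁ x₂ x₄
    + ω (bk x₀ x₄) x₁ x₂ x₃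
    - ω (bk x₁ x₂) x₀ x₃ x₄ + ω (bk x₁ x₃) x₀ x₂ x₄ - ω (bk x₁ x₄) x₀ x₂ x₃
    - ω (bk x₂ x₃) x₀ x₁ x₄ + ω (bk x₂ x₄) x₀ x₁ x₃
    - ω (bk x₃ x₄) x₀ x₁ x₂

end CE

section Std

variable {A : Type} [CommRing A] [Algebra ℝ A]
variable (F : Submodule A (Derivation ℝ A A))
variable {G : Type} [AddCommGroup G] [Module A G] [Module ℝ G] [IsScalarTower ℝ A G]

/-- the leafwise Lie bracket on the integrable subbundle `F` -/
def fbk (hF : ∀ x y : ↥F, ⁅(x : Derivation ℝ A A), (y : Derivation ℝ A A)⁆ ∈ F)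
    (x y : ↥F) : ↥F :=
  ⟨⁅(x : Derivation ℝ A A), (y : Derivation ℝ A A)⁆, hF x y⟩

/-- the action of vector fields tangent to `F` on functions -/
def fact (x : ↥F) (f : A) : A := (x : Derivation ℝ A A) f

/-- the 4-form `⟨R∧R⟩` on `F` -/
noncomputable def pontR (ipG : G → G → A) (Rm : ↥F → ↥F → G)
    (x₁ x₂ x₃ x₄ : ↥F) : A :=
  (4:ℝ)⁻¹ • ∑ σ : Equiv.Perm (Fin 4),
    (Equiv.Perm.sign σ : ℤ) •
      ipG (Rm (![x₁, x₂, x₃, x₄] (σ 0)) (![x₁, x₂, x₃, x₄] (σ 1)))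
          (Rm (![x₁, x₂, x₃, x₄] (σ 2)) (![x₁, x₂, x₃, x₄] (σ 3)))

/-- the standard bracket on `𝒜^s = 𝒢⊕F` determined by `(F,𝒢;∇,R)`:
`[r,s] = [r,s]_𝒢`, `[x,y] = R(x,y) + [x,y]`, `[x,r] = ∇_x r` -/
def stdBkt (hF : ∀ x y : ↥F, ⁅(x : Derivation ℝ A A), (y : Derivation ℝ A A)⁆ ∈ F)
    (lG : G → G → G) (Nb : ↥F → G → G) (Rm : ↥F → ↥F → G)
    (p q : G × ↥F) : G × ↥F :=
  (lG p.1 q.1 + Nb p.2 q.1 - Nb q.2 p.1 + Rm p.2 q.2, fbk F hF p.2 q.2)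

/-- the anchor of `𝒜^s = 𝒢⊕F` acting on functions -/
def stdAct (p : G × ↥F) (f : A) : A := (p.2 : Derivation ℝ A A) f

/-- the standard 3-form `C^s` on `𝒜^s = 𝒢⊕F` -/
def stdCs (lG : G → G → G) (ipG : G → G → A) (Rm : ↥F → ↥F → G)
    (Hm : ↥F → ↥F → ↥F → A) (p q w : G × ↥F) : A :=
  Hm p.2 q.2 w.2 - ipG (lG p.1 q.1) w.1
    + ipG (Rm p.2 q.2) w.1 + ipG (Rm q.2 w.2) p.1 + ipG (Rm w.2 p.2) q.1

end Std

section Helpers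

/-- Antisymmetrization over four indices of a function with the symmetries of a product of two
`2`-forms. -/
theorem sum_perm_fin_four_sign_smul {M : Type*} [AddCommGroup M]
    (f : Fin 4 → Fin 4 → Fin 4 → Fin 4 → M)
    (hskew : ∀ i j k l, f j i k l = - f i j k l) (hswap : ∀ i j k l, f k l i j = f i j k l) :
    ∑ σ : Equiv.Perm (Fin 4), (Equiv.Perm.sign σ : ℤ) • f (σ 0) (σ 1) (σ 2) (σ 3) =
      8 • (f 0 1 2 3 - f 0 2 1 3 + f 0 3 1 2) := by
  have h3 : (3 : Fin 4) = Fin.succ 2 := rfl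
  have h2 : (2 : Fin 4) = Fin.succ 1 := rfl
  have h1 : (1 : Fin 4) = Fin.succ 0 := rfl
  have h2' : (2 : Fin 3) = Fin.succ 1 := rfl
  have h1' : (1 : Fin 3) = Fin.succ 0 := rfl
  have h1'' : (1 : Fin 2) = Fin.succ 0 := rfl
  have hskew' : ∀ i j k l, f i j l k = - f i j k l := fun i j k l => by
    rw [← hswap, hskew, hswap]
  trans f 0 1 2 3 + -f 0 1 3 2 + (-f 0 2 1 3 + f 0 2 3 1 + (-f 0 3 2 1 + f 0 3 1 2)) +
      (-f 1 0 2 3 + f 1 0 3 2 + (f 1 2 0 3 + -f 1 2 3 0 + (f 1 3 2 0 + -f 1 3 0 2)) +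
        (-f 2 1 0 3 + f 2 1 3 0 + (f 2 0 1 3 + -f 2 0 3 1 + (f 2 3 0 1 + -f 2 3 1 0)) +
          (-f 3 1 2 0 + f 3 1 0 2 + (f 3 2 1 0 + -f 3 2 0 1 + (f 3 0 2 1 + -f 3 0 1 2)))))
  · simp only [Finset.univ_perm_fin_succ, Finset.sum_map, ← Finset.univ_product_univ,
      Finset.sum_product, Fin.sum_univ_succ, Equiv.coe_toEmbedding, Finset.univ_unique,
      Finset.sum_singleton, Equiv.Perm.decomposeFin.symm_sign, h1, h2, h3, h2', h1', h1'',
      Equiv.Perm.decomposeFin_symm_apply_succ, Equiv.Perm.decomposeFin_symm_apply_zero,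
      Equiv.swap_apply_def]
    simp
  · simp only [hskew 0 1, hskew 0 2, hskew 0 3, hskew 1 2, hskew 1 3, hskew 2 3,
      hskew' _ _ 0 1, hskew' _ _ 0 2, hskew' _ _ 0 3, hskew' _ _ 1 2, hskew' _ _ 1 3,
      hskew' _ _ 2 3, hswap 0 1 2 3, hswap 0 2 1 3, hswap 0 3 1 2]
    abel

variable {A : Type} [CommRing A] [Algebra ℝ A]
variable (F : Submodule A (Derivation ℝ A A))
variable {G : Type} [AddCommGroup G] [Module A G]

theorem fbk_skew (hF : ∀ x y : ↥F, ⁅(x : Derivation ℝ A A), (y : Derivation ℝ A A)⁆ ∈ F)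
    (x y : ↥F) : fbk F hF x y = - fbk F hF y x :=
  Subtype.ext (lie_skew (x : Derivation ℝ A A) (y : Derivation ℝ A A)).symm

/-- `⟨R∧R⟩` as a sum over the three pairings of the four arguments. -/
theorem pontR_eq (ipG : G →ₗ[A] G →ₗ[A] A) (Rm : ↥F → ↥F → G)
    (ipG_symm : ∀ r s, ipG r s = ipG s r) (Rm_skew : ∀ x y, Rm x y = - Rm y x)
    (x₀ x₁ x₂ x₃ : ↥F) :
    pontR F (fun r s => ipG r s) Rm x₀ x₁ x₂ x₃ =
      2 * (ipG (Rm x₀ x₁) (Rm x₂ x₃) - ipG (Rm x₀ x₂) (Rm x₁ x₃)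
        + ipG (Rm x₀ x₃) (Rm x₁ x₂)) := by
  have key := sum_perm_fin_four_sign_smul
    (fun i j k l => ipG (Rm (![x₀, x₁, x₂, x₃] i) (![x₀, x₁, x₂, x₃] j))
      (Rm (![x₀, x₁, x₂, x₃] k) (![x₀, x₁, x₂, x₃] l)))
    (fun i j k l => by
      rw [Rm_skew (![x₀, x₁, x₂, x₃] j) (![x₀, x₁, x₂, x₃] i), map_neg, LinearMap.neg_apply])
    (fun i j k l => ipG_symm _ _)
  unfold pontR
  rw [key, ← Nat.cast_smul_eq_nsmul ℝ, smul_smul]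
  simp only [Matrix.cons_val]
  rw [show (4 : ℝ)⁻¹ * ((8 : ℕ) : ℝ) = 2 by norm_num, ofNat_smul_eq_nsmul, two_nsmul, two_mul]

/-- The differential of `C^s` is the pullback to `𝒜^s` of `d^Fℋ - ⟨R∧R⟩`. -/
theorem dCE3_stdCs
    (hF : ∀ x y : ↥F, ⁅(x : Derivation ℝ A A), (y : Derivation ℝ A A)⁆ ∈ F)
    (lG : G →ₗ[A] G →ₗ[A] G) (ipG : G →ₗ[A] G →ₗ[A] A)
    (lG_skew : ∀ r s, lG r s = - lG s r)
    (lG_jacobi : ∀ r s t, lG r (lG s t) = lG (lG r s) t + lG s (lG r t))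
    (ipG_symm : ∀ r s, ipG r s = ipG s r)
    (ipG_ad : ∀ r s t, ipG (lG r s) t + ipG s (lG r t) = 0)
    (Nb : ↥F → G → G) (Rm : ↥F → ↥F → G)
    (Nb_add₂ : ∀ x r r', Nb x (r + r') = Nb x r + Nb x r')
    (Rm_neg : ∀ x y, Rm x (-y) = - Rm x y)
    (Rm_skew : ∀ x y, Rm x y = - Rm y x)
    (c1 : ∀ x r s, fact F x (ipG r s) = ipG (Nb x r) s + ipG r (Nb x s))
    (c2 : ∀ x r s, Nb x (lG r s) = lG (Nb x r) s + lG r (Nb x s))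
    (c3 : ∀ x y z, (Nb x (Rm y z) - Rm (fbk F hF x y) z)
      + (Nb y (Rm z x) - Rm (fbk F hF y z) x)
      + (Nb z (Rm x y) - Rm (fbk F hF z x) y) = 0)
    (Hm : ↥F → ↥F → ↥F → A) (p₀ p₁ p₂ p₃ : G × ↥F) :
    dCE3 (stdAct F) (stdBkt F hF (fun r s => lG r s) Nb Rm)
        (stdCs F (fun r s => lG r s) (fun r s => ipG r s) Rm Hm) p₀ p₁ p₂ p₃ =
      dCE3 (fact F) (fbk F hF) Hm p₀.2 p₁.2 p₂.2 p₃.2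
        - pontR F (fun r s => ipG r s) Rm p₀.2 p₁.2 p₂.2 p₃.2 := by
  rw [pontR_eq F ipG Rm ipG_symm Rm_skew]
  have ad (a b c : G) : ipG (lG a b) c = ipG a (lG b c) := by
    rw [lG_skew a b, map_neg, LinearMap.neg_apply]
    linear_combination - ipG_ad b a c
  have cyc (a b c : G) : ipG (lG a b) c = ipG (lG c a) b := by
    rw [ad c a b, ipG_symm]
  have pair (a b c d : G) : ipG (lG (lG a b) c) d = ipG (lG (lG c d) a) b := by
    rw [ad, ad (lG c d), ipG_symm]
  have Nb_neg (x : ↥F) (r : G) : Nb x (-r) = - Nb x r := by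
    have h0 : Nb x 0 = 0 := by simpa using Nb_add₂ x 0 0
    rw [eq_neg_iff_add_eq_zero, ← Nb_add₂, neg_add_cancel, h0]
  have bianchi (x y z : ↥F) (r : G) : ipG (Nb x (Rm y z)) r - ipG (Nb y (Rm x z)) r
      + ipG (Nb z (Rm x y)) r - ipG (Rm (fbk F hF x y) z) r + ipG (Rm (fbk F hF x z) y) r
      - ipG (Rm (fbk F hF y z) x) r = 0 := by
    have h := congrArg (fun s => ipG s r) (c3 x y z)
    have hR : Rm (fbk F hF z x) y = - Rm (fbk F hF x z) y := by
      rw [fbk_skew F hF z x, Rm_skew, Rm_neg, neg_neg, Rm_skew]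
    rw [Rm_skew z x, Nb_neg, hR] at h
    simp only [map_add, map_sub, map_neg, map_zero, LinearMap.add_apply, LinearMap.sub_apply,
      LinearMap.neg_apply, LinearMap.zero_apply] at h
    linear_combination h
  have jacobi (a b c d : G) : ipG (lG (lG a b) c) d - ipG (lG (lG a c) b) d
      + ipG (lG (lG b c) a) d = 0 := by
    have h := congrArg (fun s => ipG s d) (lG_jacobi a b c)
    rw [lG_skew a (lG b c), lG_skew b (lG a c)] at h
    simp only [map_add, map_neg, LinearMap.add_apply, LinearMap.neg_apply] at h
    linear_combination -h
  obtain ⟨r₀, x₀⟩ := p₀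
  obtain ⟨r₁, x₁⟩ := p₁
  obtain ⟨r₂, x₂⟩ := p₂
  obtain ⟨r₃, x₃⟩ := p₃
  unfold fact at c1
  have lG_Nb (a : G) (x : ↥F) (r : G) : lG a (Nb x r) = - lG (Nb x r) a := lG_skew _ _
  have cyc_Nb (a b : G) (x : ↥F) (r : G) :
      ipG (lG a b) (Nb x r) = ipG (lG (Nb x r) a) b := cyc _ _ _
  have ad_R (x y : ↥F) (a b : G) : ipG (lG (Rm x y) a) b = ipG (Rm x y) (lG a b) := ad _ _ _
  have R_fbk (x y z : ↥F) : Rm x (fbk F hF y z) = - Rm (fbk F hF y z) x := Rm_skew _ _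
  simp only [dCE3, stdAct, stdBkt, stdCs, fact, map_add, map_sub, map_neg, c1, c2, R_fbk,
    Rm_skew x₂ x₀, Rm_skew x₃ x₀, Rm_skew x₃ x₁, lG_Nb, cyc_Nb, ad_R,
    LinearMap.add_apply, LinearMap.sub_apply, LinearMap.neg_apply]
  linear_combination bianchi x₀ x₁ x₂ r₃ - bianchi x₀ x₁ x₃ r₂ + bianchi x₀ x₂ x₃ r₁
    - bianchi x₁ x₂ x₃ r₀
    - ipG_symm (Rm x₂ x₃) (Rm x₀ x₁) + ipG_symm (Rm x₁ x₃) (Rm x₀ x₂)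
    - ipG_symm (Rm x₁ x₂) (Rm x₀ x₃)
    + 2 * jacobi r₀ r₁ r₂ r₃ - pair r₁ r₂ r₀ r₃ + pair r₀ r₂ r₁ r₃ - pair r₀ r₁ r₂ r₃

end Helpers

/-- For the standard quadratic Lie algebroid `𝒜^s` determined by a
quadruple `(F,𝒢;∇,R)` satisfying (i)-(iv) and a 3-form `ℋ` on `F`, TFAE:
(a) `d^Fℋ = ⟨R∧R⟩`; (b) `C^s` is closed; (c) `C^s` is a coherent 3-form. -/
theorem statement12
    {A : Type} [CommRing A] [Algebra ℝ A]
    (F : Submodule A (Derivation ℝ A A))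
    (hF : ∀ x y : ↥F, ⁅(x : Derivation ℝ A A), (y : Derivation ℝ A A)⁆ ∈ F)
    {G : Type} [AddCommGroup G] [Module A G] [Module ℝ G] [IsScalarTower ℝ A G]
    -- 𝒢 is a bundle of quadratic Lie algebras
    (lG : G →ₗ[A] G →ₗ[A] G) (ipG : G →ₗ[A] G →ₗ[A] A)
    (lG_skew : ∀ r s, lG r s = - lG s r)
    (lG_jacobi : ∀ r s t, lG r (lG s t) = lG (lG r s) t + lG s (lG r t))
    (ipG_symm : ∀ r s, ipG r s = ipG s r)
    (ipG_nondeg : ∀ r, (∀ s, ipG r s = 0) → r = 0)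
    (ipG_ad : ∀ r s t, ipG (lG r s) t + ipG s (lG r t) = 0)
    -- the quadruple (F,𝒢;∇,R) with its linearity properties
    (Nb : ↥F → G → G) (Rm : ↥F → ↥F → G)
    (Nb_add₁ : ∀ x x' r, Nb (x + x') r = Nb x r + Nb x' r)
    (Nb_smul₁ : ∀ (f : A) x r, Nb (f • x) r = f • Nb x r)
    (Nb_add₂ : ∀ x r r', Nb x (r + r') = Nb x r + Nb x r')
    (Nb_leibniz : ∀ x (f : A) r, Nb x (f • r) = f • Nb x r + fact F x f • r)
    (Rm_skew : ∀ x y, Rm x y = - Rm y x)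
    (Rm_lin : ∀ (f : A) x x' y, Rm (f • x + x') y = f • Rm x y + Rm x' y)
    -- the compatibility conditions (i)-(iv)
    (c1 : ∀ x r s, fact F x (ipG r s) = ipG (Nb x r) s + ipG r (Nb x s))
    (c2 : ∀ x r s, Nb x (lG r s) = lG (Nb x r) s + lG r (Nb x s))
    (c3 : ∀ x y z, (Nb x (Rm y z) - Rm (fbk F hF x y) z)
      + (Nb y (Rm z x) - Rm (fbk F hF y z) x)
      + (Nb z (Rm x y) - Rm (fbk F hF z x) y) = 0)
    (c4 : ∀ x y r, Nb x (Nb y r) - Nb y (Nb x r) - Nb (fbk F hF x y) r = lG (Rm x y) r)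
    -- the 3-form ℋ on F
    (Hm : ↥F → ↥F → ↥F → A)
    (Hm_lin : ∀ (f : A) x x' y z, Hm (f • x + x') y z = f * Hm x y z + Hm x' y z)
    (Hm_skew₁ : ∀ x y z, Hm x y z = - Hm y x z)
    (Hm_skew₂ : ∀ x y z, Hm x y z = - Hm x z y) :
    -- (a) ⟺ (b)
    ((∀ x₁ x₂ x₃ x₄ : ↥F,
        dCE3 (fact F) (fbk F hF) Hm x₁ x₂ x₃ x₄
          = pontR F (fun r s => ipG r s) Rm x₁ x₂ x₃ x₄) ↔
      (∀ p₀ p₁ p₂ p₃ : G × ↥F,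
        dCE3 (stdAct F) (stdBkt F hF (fun r s => lG r s) Nb Rm)
          (stdCs F (fun r s => lG r s) (fun r s => ipG r s) Rm Hm) p₀ p₁ p₂ p₃ = 0)) ∧
    -- (b) ⟺ (c): C^s is closed iff it is a coherent 3-form on 𝒜^s
    ((∀ p₀ p₁ p₂ p₃ : G × ↥F,
        dCE3 (stdAct F) (stdBkt F hF (fun r s => lG r s) Nb Rm)
          (stdCs F (fun r s => lG r s) (fun r s => ipG r s) Rm Hm) p₀ p₁ p₂ p₃ = 0) ↔
      ((∀ p₀ p₁ p₂ p₃ : G × ↥F,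
        dCE3 (stdAct F) (stdBkt F hF (fun r s => lG r s) Nb Rm)
          (stdCs F (fun r s => lG r s) (fun r s => ipG r s) Rm Hm) p₀ p₁ p₂ p₃ = 0) ∧
       ∃ km : ↥F →ₗ[A] (G × ↥F),
        -- km is a hoist of 𝒜^s ...
        (∀ x, (km x).2 = x) ∧
        -- ... with respect to which C^s is coherent:
        (∀ r s t : G,
          stdCs F (fun r s => lG r s) (fun r s => ipG r s) Rm Hm (r, 0) (s, 0) (t, 0)
            = - ipG (lG r s) t) ∧
        (∀ (r s : G) (x : ↥F),
          stdCs F (fun r s => lG r s) (fun r s => ipG r s) Rm Hm (r, 0) (s, 0) (km x)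
            = 0) ∧
        (∀ (r : G) (x y : ↥F),
          stdCs F (fun r s => lG r s) (fun r s => ipG r s) Rm Hm (r, 0) (km x) (km y)
            = ipG r (stdBkt F hF (fun r s => lG r s) Nb Rm (km x) (km y)
                - km (fbk F hF x y)).1))) := by
  have Rm0 : ∀ y, Rm 0 y = 0 := fun y => by simpa using Rm_lin 1 0 0 y
  have Rm_neg : ∀ x y, Rm x (-y) = - Rm x y := fun x y => by
    have h : 0 = Rm y x + Rm (-y) x := by simpa [Rm0] using Rm_lin 1 y (-y) x
    rw [Rm_skew x y, Rm_skew, neg_neg, neg_eq_iff_add_eq_zero, add_comm, ← h]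
  have key := dCE3_stdCs F hF lG ipG lG_skew lG_jacobi ipG_symm ipG_ad Nb Rm Nb_add₂ Rm_neg
    Rm_skew c1 c2 c3 Hm
  have Rm0' : ∀ y, Rm y 0 = 0 := fun y => by rw [Rm_skew, Rm0, neg_zero]
  have Hm0 : ∀ y z, Hm 0 y z = 0 := fun y z => by simpa using Hm_lin 1 0 0 y z
  have Nb0 : ∀ x, Nb x 0 = 0 := fun x => by simpa using Nb_add₂ x 0 0
  refine ⟨⟨fun h p₀ p₁ p₂ p₃ => ?_, fun h x₁ x₂ x₃ x₄ => ?_⟩, fun h => ⟨h, ?_⟩, And.left⟩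
  · rw [key, h, sub_self]
  · exact sub_eq_zero.mp ((key (0, x₁) (0, x₂) (0, x₃) (0, x₄)).symm.trans (h _ _ _ _))
  · refine ⟨LinearMap.inr A G ↥F, fun x => rfl, fun r s t => ?_, fun r s x => ?_,
      fun r x y => ?_⟩
    · simp [stdCs, Rm0, Hm0]
    · simp [stdCs, Rm0, Rm0', Hm0]
    · simp [stdCs, stdBkt, Rm0, Rm0', Hm0, Nb0, ipG_symm r]
end

section
/- Let E^s₁ and E^s₂ be two standard Courant algebroid structures on F*⊕𝒢⊕F. Then any isomorphism of Courant algebroids Θ : E^s₁ → E^s₂ has the form Θ(ξ+r+x) = (ξ + β(x) − 2φ*τ(r)) + (τ(r) + φ(x)) + x, where τ is an automorphism of the bundle of quadratic Lie algebras 𝒢 and φ : F → 𝒢, β : F → F* are bundle maps satisfying: ½⟨β(x),y⟩ + ½⟨x,β(y)⟩ + ⟨φ(x),φ(y)⟩_𝒢 = 0; ∇²_x τ(r) − τ∇¹_x(r) = [τ(r),φ(x)]_𝒢; R²(x,y) − τR¹(x,y) = τ(∇¹_y τ⁻¹φ(x) − ∇¹_x τ⁻¹φ(y)) + φ[x,y]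 + [φ(x),φ(y)]_𝒢; and ℋ²(x,y,z) − ℋ¹(x,y,z) + 2⟨φ(x),[φ(y),φ(z)]_𝒢⟩_𝒢 = (2⟨φ(x), τ∇¹_y τ⁻¹φ(z) − τR¹(y,z)⟩_𝒢 + L_x⟨y,β(z)⟩ + ⟨x,β[y,z]⟩) + c.p., for all x,y,z ∈ Γ(F), r ∈ Γ(𝒢). -/
/-! # Statement 14
Any isomorphism `Θ` between two standard Courant algebroid structures on `F*⊕𝒢⊕F`
has the form `Θ(ξ+r+x) = (ξ + β(x) − 2φ*τ(r)) + (τ(r) + φ(x)) + x` for an automorphism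
`τ` of the bundle of quadratic Lie algebras `𝒢` and bundle maps `φ : F → 𝒢`,
`β : F → F*` satisfying the four compatibility equations.

Algebraic model: `A` plays the role of `C^∞(M)`, vector fields are
`Derivation ℝ A A`, `F` is a bracket-closed `A`-submodule of `Derivation ℝ A A`. -/

/-- A Courant algebroid (in algebraic form). -/
structure CourantAlgebroid (A : Type) [CommRing A] [Algebra ℝ A]
    (E : Type) [AddCommGroup E] [Module A E] [Module ℝ E] [IsScalarTower ℝ A E] where
  /-- the pseudo-metric `⟨-,-⟩` -/
  ip : E →ₗ[A] E →ₗ[A] A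
  /-- the anchor `ρ` -/
  rho : E →ₗ[A] Derivation ℝ A A
  /-- the Dorfman bracket `∘` (ℝ-bilinear) -/
  dorf : E →ₗ[ℝ] E →ₗ[ℝ] E
  /-- the map `𝒟 : C^∞(M) → Γ(E)` -/
  Dmap : A → E
  ip_symm : ∀ e₁ e₂, ip e₁ e₂ = ip e₂ e₁
  /-- fiberwise nondegeneracy of the pseudo-metric: `Ξ : E → E*` is bijective -/
  ip_nondeg : Function.Bijective fun e => ip e
  /-- `⟨𝒟f, e⟩ = ½ ρ(e) f` -/
  ip_D : ∀ (f : A) (e : E), (2 : A) * ip (Dmap f) e = rho e f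
  /-- `ρ ∘ 𝒟 = 0` -/
  rho_D : ∀ f : A, rho (Dmap f) = 0
  dorf_jacobi : ∀ e₁ e₂ e₃,
    dorf e₁ (dorf e₂ e₃) = dorf (dorf e₁ e₂) e₃ + dorf e₂ (dorf e₁ e₃)
  rho_dorf : ∀ e₁ e₂, rho (dorf e₁ e₂) = ⁅rho e₁, rho e₂⁆
  dorf_leibniz : ∀ (e₁ : E) (f : A) (e₂ : E),
    dorf e₁ (f • e₂) = rho e₁ f • e₂ + f • dorf e₁ e₂
  dorf_sym : ∀ e₁ e₂, dorf e₁ e₂ + dorf e₂ e₁ = (2 : ℝ) • Dmap (ip e₁ e₂)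
  dorf_D : ∀ (f : A) (e : E), dorf (Dmap f) e = 0
  rho_ip : ∀ e₁ e₂ e₃,
    rho e₁ (ip e₂ e₃) = ip (dorf e₁ e₂) e₃ + ip e₂ (dorf e₁ e₃)

namespace CourantAlgebroid

variable {A : Type} [CommRing A] [Algebra ℝ A]
variable {E : Type} [AddCommGroup E] [Module A E] [Module ℝ E] [IsScalarTower ℝ A E]
variable (ca : CourantAlgebroid A E)

/-- `(ker ρ)⊥`, the subbundle of `E` orthogonal to `ker ρ` w.r.t. the pseudo-metric. -/
def perp : Submodule A E where
  carrier := {e | ∀ k ∈ LinearMap.ker ca.rho, ca.ip e k = 0}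
  add_mem' := by
    intro a b ha hb k hk
    simp [map_add, ha k hk, hb k hk]
  zero_mem' := by intro k hk; simp
  smul_mem' := by
    intro c x hx k hk
    simp [map_smul, hx k hk]

/-- Regularity (constant rank of the anchor), expressed by the splitting of the two
canonical short exact sequences `0 → ker ρ → E → F → 0` and
`0 → (ker ρ)⊥ → ker ρ → 𝒢 → 0`. -/
def IsRegular : Prop :=
  (∃ lam : ↥(LinearMap.range ca.rho) →ₗ[A] E, ∀ x, ca.rho (lam x) = ↑x) ∧
  (∃ sig : (↥(LinearMap.ker ca.rho) ⧸
        (ca.perp.comap (LinearMap.ker ca.rho).subtype)) →ₗ[A] ↥(LinearMap.ker ca.rho),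
      ∀ g, (ca.perp.comap (LinearMap.ker ca.rho).subtype).mkQ (sig g) = g)

lemma dorf_mem_ker {r s : E} (hr : r ∈ LinearMap.ker ca.rho)
    (hs : s ∈ LinearMap.ker ca.rho) : ca.dorf r s ∈ LinearMap.ker ca.rho := by
  rw [LinearMap.mem_ker] at *
  rw [ca.rho_dorf, hr, hs, zero_lie]

lemma dorf_ker_left_mem_ker (e : E) {r : E} (hr : r ∈ LinearMap.ker ca.rho) :
    ca.dorf e r ∈ LinearMap.ker ca.rho := by
  rw [LinearMap.mem_ker] at *
  rw [ca.rho_dorf, hr, lie_zero]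

/-- sections of `ker ρ` -/
abbrev Ker := ↥(LinearMap.ker ca.rho)

/-- `(ker ρ)⊥` viewed inside `ker ρ` -/
abbrev perp' : Submodule A ca.Ker := ca.perp.comap (LinearMap.ker ca.rho).subtype

/-- `𝒢 := ker ρ/(ker ρ)⊥` -/
abbrev Gq := ca.Ker ⧸ ca.perp'

/-- the projection `π : ker ρ → 𝒢` -/
abbrev piG : ca.Ker →ₗ[A] ca.Gq := ca.perp'.mkQ

/-- the ample quotient `𝒜_E := E/(ker ρ)⊥` -/
abbrev Ample := E ⧸ ca.perp

/-- the projection `q : E → 𝒜_E` -/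
abbrev qA : E →ₗ[A] ca.Ample := ca.perp.mkQ

/-- Dorfman bracket of two sections of `ker ρ`, viewed in `ker ρ`. -/
def dorfK (r s : ca.Ker) : ca.Ker := ⟨ca.dorf ↑r ↑s, ca.dorf_mem_ker r.2 s.2⟩

/-- Dorfman bracket of a section of `E` with a section of `ker ρ`, viewed in `ker ρ`. -/
def dorfEK (e : E) (r : ca.Ker) : ca.Ker := ⟨ca.dorf e ↑r, ca.dorf_ker_left_mem_ker e r.2⟩

end CourantAlgebroid

section StandardCA

variable {A : Type} [CommRing A] [Algebra ℝ A]
variable (F : Submodule A (Derivation ℝ A A))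
variable {G : Type} [AddCommGroup G] [Module A G] [Module ℝ G] [IsScalarTower ℝ A G]

/-- A standard Courant algebroid structure on `F*⊕𝒢⊕F`: the anchor is the projection
onto `F`, the pseudo-metric is `½⟨ξ₁,x₂⟩ + ½⟨ξ₂,x₁⟩ + ⟨r₁,r₂⟩_𝒢`, and the 𝒢-component
of the Dorfman bracket of sections of 𝒢 is the fiberwise bracket `[-,-]_𝒢`. -/
def IsStandardCA (lG : G → G → G) (ipG : G → G → A)
    (ca : CourantAlgebroid A (Module.Dual A ↥F × G × ↥F)) : Prop :=
  (∀ p, ca.rho p = ↑p.2.2) ∧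
  (∀ p q, ca.ip p q =
    (2:ℝ)⁻¹ • p.1 q.2.2 + (2:ℝ)⁻¹ • q.1 p.2.2 + ipG p.2.1 q.2.1) ∧
  (∀ r s : G, (ca.dorf (0, r, 0) (0, s, 0)).2.1 = lG r s)

variable (ca : CourantAlgebroid A (Module.Dual A ↥F × G × ↥F))

/-- the `F`-connection `∇` on `𝒢` induced by a standard Courant algebroid -/
def sNabla (x : ↥F) (r : G) : G := (ca.dorf (0, 0, x) (0, r, 0)).2.1

/-- the curvature-type bundle map `R : ∧²F → 𝒢` induced by a standard Courant algebroid -/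
def sR (x y : ↥F) : G := (ca.dorf (0, 0, x) (0, 0, y)).2.1

/-- the 3-form `ℋ ∈ Γ(∧³F*)` induced by a standard Courant algebroid -/
def sH (x y z : ↥F) : A := (ca.dorf (0, 0, x) (0, 0, y)).1 z

end StandardCA

section NormalForm

variable {A : Type} [CommRing A] [Algebra ℝ A]

lemma two_mul_cancel_of_real_algebra {a b : A} (h : 2 * a = 2 * b) : a = b := by
  have h2 : algebraMap ℝ A 2⁻¹ * 2 = 1 := by
    rw [← map_ofNat (algebraMap ℝ A) 2, ← map_mul]
    norm_num
  calc a = algebraMap ℝ A 2⁻¹ * (2 * a) := by rw [← mul_assoc, h2, one_mul]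
    _ = b := by rw [h, ← mul_assoc, h2, one_mul]

lemma two_mul_half_smul (a : A) : 2 * ((2 : ℝ)⁻¹ • a) = a := by
  rw [two_mul, ← add_smul]
  norm_num

lemma prod_eq_add_add {X Y Z : Type*} [AddMonoid X] [AddMonoid Y] [AddMonoid Z]
    (p : X × Y × Z) : p = (p.1, 0, 0) + (0, p.2.1, 0) + (0, 0, p.2.2) := by
  ext <;> simp

namespace IsStandardCA

variable {F : Submodule A (Derivation ℝ A A)}
variable {G : Type} [AddCommGroup G] [Module A G] [Module ℝ G] [IsScalarTower ℝ A G]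
variable {lG : G →ₗ[A] G →ₗ[A] G} {ipG : G →ₗ[A] G →ₗ[A] A}
variable {ca : CourantAlgebroid A (Module.Dual A ↥F × G × ↥F)}

lemma two_mul_ip (h : IsStandardCA F (fun r s => lG r s) (fun r s => ipG r s) ca)
    (p q : Module.Dual A ↥F × G × ↥F) :
    2 * ca.ip p q = p.1 q.2.2 + q.1 p.2.2 + 2 * ipG p.2.1 q.2.1 := by
  rw [h.2.1, mul_add, mul_add, two_mul_half_smul, two_mul_half_smul]

lemma anchor_dorf (h : IsStandardCA F (fun r s => lG r s) (fun r s => ipG r s) ca)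
    (hF : ∀ x y : ↥F, ⁅(x : Derivation ℝ A A), (y : Derivation ℝ A A)⁆ ∈ F)
    (p q : Module.Dual A ↥F × G × ↥F) :
    (ca.dorf p q).2.2 = fbk F hF p.2.2 q.2.2 := by
  apply Subtype.ext
  rw [← h.1, ca.rho_dorf, h.1, h.1]
  rfl

lemma anchor_dorf_right_eq_zero
    (h : IsStandardCA F (fun r s => lG r s) (fun r s => ipG r s) ca)
    (p : Module.Dual A ↥F × G × ↥F) {q : Module.Dual A ↥F × G × ↥F} (hq : q.2.2 = 0) :
    (ca.dorf p q).2.2 = 0 := by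
  apply Subtype.ext
  rw [← h.1, ca.rho_dorf, h.1 q, hq]
  simp

lemma anchor_dorf_left_eq_zero
    (h : IsStandardCA F (fun r s => lG r s) (fun r s => ipG r s) ca)
    {p : Module.Dual A ↥F × G × ↥F} (q : Module.Dual A ↥F × G × ↥F) (hp : p.2.2 = 0) :
    (ca.dorf p q).2.2 = 0 := by
  apply Subtype.ext
  rw [← h.1, ca.rho_dorf, h.1 p, hp]
  simp

lemma fact_pairing (h : IsStandardCA F (fun r s => lG r s) (fun r s => ipG r s) ca)
    (e p q : Module.Dual A ↥F × G × ↥F) :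
    fact F e.2.2 (p.1 q.2.2 + q.1 p.2.2 + 2 * ipG p.2.1 q.2.1) =
      ((ca.dorf e p).1 q.2.2 + q.1 (ca.dorf e p).2.2 + 2 * ipG (ca.dorf e p).2.1 q.2.1) +
      (p.1 (ca.dorf e q).2.2 + (ca.dorf e q).1 p.2.2 + 2 * ipG p.2.1 (ca.dorf e q).2.1) := by
  rw [← h.two_mul_ip, ← h.two_mul_ip, ← h.two_mul_ip, ← mul_add, ← ca.rho_ip, h.1, fact,
    two_mul, map_add, ← two_mul]

lemma anchor_Dmap (h : IsStandardCA F (fun r s => lG r s) (fun r s => ipG r s) ca) (f : A) :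
    (ca.Dmap f).2.2 = 0 := by
  apply Subtype.ext
  rw [← h.1, ca.rho_D]
  rfl

lemma Dmap_pairing (h : IsStandardCA F (fun r s => lG r s) (fun r s => ipG r s) ca) (f : A)
    (e : Module.Dual A ↥F × G × ↥F) :
    (ca.Dmap f).1 e.2.2 + 2 * ipG (ca.Dmap f).2.1 e.2.1 = fact F e.2.2 f := by
  have := ca.ip_D f e
  rw [h.two_mul_ip, h.1, h.anchor_Dmap, map_zero, add_zero] at this
  exact this

lemma Dmap_fst_apply (h : IsStandardCA F (fun r s => lG r s) (fun r s => ipG r s) ca) (f : A)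
    (z : ↥F) : (ca.Dmap f).1 z = fact F z f := by
  simpa using h.Dmap_pairing f (0, 0, z)

lemma Dmap_snd_fst (h : IsStandardCA F (fun r s => lG r s) (fun r s => ipG r s) ca)
    (ipG_nondeg : ∀ r, (∀ s, ipG r s = 0) → r = 0) (f : A) : (ca.Dmap f).2.1 = 0 := by
  refine ipG_nondeg _ fun s => two_mul_cancel_of_real_algebra ?_
  simpa [fact] using h.Dmap_pairing f (0, s, 0)

lemma dorf_add_dorf_fst (h : IsStandardCA F (fun r s => lG r s) (fun r s => ipG r s) ca)
    (p q : Module.Dual A ↥F × G × ↥F) (z : ↥F) :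
    (ca.dorf p q).1 z + (ca.dorf q p).1 z =
      fact F z (p.1 q.2.2 + q.1 p.2.2 + 2 * ipG p.2.1 q.2.1) := by
  have := congrArg (fun e : Module.Dual A ↥F × G × ↥F => e.1 z) (ca.dorf_sym p q)
  simp only [Prod.fst_add, LinearMap.add_apply, Prod.smul_fst, LinearMap.smul_apply,
    h.Dmap_fst_apply] at this
  rw [this, ← h.two_mul_ip, fact, fact, two_mul, map_add, two_smul]

lemma dorf_add_dorf_snd (h : IsStandardCA F (fun r s => lG r s) (fun r s => ipG r s) ca)
    (ipG_nondeg : ∀ r, (∀ s, ipG r s = 0) → r = 0) (p q : Module.Dual A ↥F × G × ↥F) :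
    (ca.dorf p q).2.1 + (ca.dorf q p).2.1 = 0 := by
  have := congrArg (fun e : Module.Dual A ↥F × G × ↥F => e.2.1) (ca.dorf_sym p q)
  simpa [h.Dmap_snd_fst ipG_nondeg] using this

lemma dorf_covector_right_snd
    (h : IsStandardCA F (fun r s => lG r s) (fun r s => ipG r s) ca)
    (ipG_nondeg : ∀ r, (∀ s, ipG r s = 0) → r = 0) (e : Module.Dual A ↥F × G × ↥F)
    (ξ : Module.Dual A ↥F) : (ca.dorf e (ξ, 0, 0)).2.1 = 0 := by
  refine ipG_nondeg _ fun s => two_mul_cancel_of_real_algebra ?_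
  have := h.fact_pairing e (ξ, 0, 0) (0, s, 0)
  simpa [fact, h.anchor_dorf_right_eq_zero e (q := (0, s, 0)) rfl] using this.symm

lemma dorf_covector_left_snd
    (h : IsStandardCA F (fun r s => lG r s) (fun r s => ipG r s) ca)
    (ipG_nondeg : ∀ r, (∀ s, ipG r s = 0) → r = 0) (ξ : Module.Dual A ↥F)
    (e : Module.Dual A ↥F × G × ↥F) : (ca.dorf (ξ, 0, 0) e).2.1 = 0 := by
  simpa [h.dorf_covector_right_snd ipG_nondeg] using
    h.dorf_add_dorf_snd ipG_nondeg (ξ, 0, 0) e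

lemma dorf_covector_right_fst
    (h : IsStandardCA F (fun r s => lG r s) (fun r s => ipG r s) ca)
    (hF : ∀ x y : ↥F, ⁅(x : Derivation ℝ A A), (y : Derivation ℝ A A)⁆ ∈ F)
    (e : Module.Dual A ↥F × G × ↥F) (ξ : Module.Dual A ↥F) (z : ↥F) :
    (ca.dorf e (ξ, 0, 0)).1 z = fact F e.2.2 (ξ z) - ξ (fbk F hF e.2.2 z) := by
  have := h.fact_pairing e (ξ, 0, 0) (0, 0, z)
  simp only [h.anchor_dorf hF, map_zero, LinearMap.zero_apply, mul_zero, add_zero] at this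
  rw [this]
  ring

lemma dorf_covector_left_fst
    (h : IsStandardCA F (fun r s => lG r s) (fun r s => ipG r s) ca)
    (hF : ∀ x y : ↥F, ⁅(x : Derivation ℝ A A), (y : Derivation ℝ A A)⁆ ∈ F)
    (ξ : Module.Dual A ↥F) (e : Module.Dual A ↥F × G × ↥F) (z : ↥F) :
    (ca.dorf (ξ, 0, 0) e).1 z =
      fact F z (ξ e.2.2) - fact F e.2.2 (ξ z) + ξ (fbk F hF e.2.2 z) := by
  have := h.dorf_add_dorf_fst (ξ, 0, 0) e z
  simp only [h.dorf_covector_right_fst hF, map_zero, LinearMap.zero_apply, mul_zero,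
    add_zero] at this
  linear_combination this

lemma dorf_vector_section_fst
    (h : IsStandardCA F (fun r s => lG r s) (fun r s => ipG r s) ca)
    (x : ↥F) (s : G) (z : ↥F) :
    (ca.dorf (0, 0, x) (0, s, 0)).1 z = -2 * ipG s (sR F ca x z) := by
  have := h.fact_pairing (0, 0, x) (0, s, 0) (0, 0, z)
  simp only [fact, map_zero, LinearMap.zero_apply, mul_zero, add_zero, zero_add] at this
  rw [sR]
  linear_combination -this

lemma dorf_section_vector_snd
    (h : IsStandardCA F (fun r s => lG r s) (fun r s => ipG r s) ca)
    (ipG_nondeg : ∀ r, (∀ s, ipG r s = 0) → r = 0) (r : G) (y : ↥F) :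
    (ca.dorf (0, r, 0) (0, 0, y)).2.1 = -sNabla F ca y r :=
  eq_neg_of_add_eq_zero_left (h.dorf_add_dorf_snd ipG_nondeg _ _)

lemma dorf_section_vector_fst
    (h : IsStandardCA F (fun r s => lG r s) (fun r s => ipG r s) ca)
    (r : G) (y z : ↥F) :
    (ca.dorf (0, r, 0) (0, 0, y)).1 z = 2 * ipG r (sR F ca y z) := by
  have := h.dorf_add_dorf_fst (0, r, 0) (0, 0, y) z
  simp only [h.dorf_vector_section_fst, fact, map_zero, LinearMap.zero_apply, mul_zero,
    add_zero] at this
  linear_combination this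

lemma dorf_section_section_fst
    (h : IsStandardCA F (fun r s => lG r s) (fun r s => ipG r s) ca)
    (ipG_nondeg : ∀ r, (∀ s, ipG r s = 0) → r = 0) (r s : G) (z : ↥F) :
    (ca.dorf (0, r, 0) (0, s, 0)).1 z = 2 * ipG s (sNabla F ca z r) := by
  have := h.fact_pairing (0, r, 0) (0, s, 0) (0, 0, z)
  simp only [fact, map_zero, LinearMap.zero_apply, mul_zero, add_zero, zero_add,
    h.dorf_section_vector_snd ipG_nondeg, map_neg] at this
  linear_combination -this

lemma fact_ipG (h : IsStandardCA F (fun r s => lG r s) (fun r s => ipG r s) ca)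
    (x : ↥F) (r s : G) :
    fact F x (ipG r s) = ipG (sNabla F ca x r) s + ipG r (sNabla F ca x s) := by
  apply two_mul_cancel_of_real_algebra
  have := h.fact_pairing (0, 0, x) (0, r, 0) (0, s, 0)
  simp only [map_zero, LinearMap.zero_apply, add_zero, zero_add] at this
  rw [sNabla, sNabla, mul_add, ← this, fact, fact, two_mul, two_mul, map_add]

lemma sR_skew (h : IsStandardCA F (fun r s => lG r s) (fun r s => ipG r s) ca)
    (ipG_nondeg : ∀ r, (∀ s, ipG r s = 0) → r = 0) (x y : ↥F) :
    sR F ca x y = -sR F ca y x :=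
  eq_neg_of_add_eq_zero_left (h.dorf_add_dorf_snd ipG_nondeg _ _)

/-- The `𝒢`-component of the Dorfman bracket of a standard Courant algebroid. -/
lemma dorf_snd (h : IsStandardCA F (fun r s => lG r s) (fun r s => ipG r s) ca)
    (ipG_nondeg : ∀ r, (∀ s, ipG r s = 0) → r = 0) (p q : Module.Dual A ↥F × G × ↥F) :
    (ca.dorf p q).2.1 = lG p.2.1 q.2.1 + sNabla F ca p.2.2 q.2.1 - sNabla F ca q.2.2 p.2.1
      + sR F ca p.2.2 q.2.2 := by
  conv_lhs => rw [prod_eq_add_add p]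
  rw [map_add, map_add, LinearMap.add_apply, LinearMap.add_apply]
  simp only [Prod.snd_add, Prod.fst_add, h.dorf_covector_left_snd ipG_nondeg]
  conv_lhs => rw [prod_eq_add_add q]
  simp only [map_add, Prod.snd_add, Prod.fst_add, h.dorf_covector_right_snd ipG_nondeg,
    h.2.2, h.dorf_section_vector_snd ipG_nondeg]
  simp only [sNabla, sR]
  abel

/-- The `F*`-component of the Dorfman bracket of a standard Courant algebroid. -/
lemma dorf_fst (h : IsStandardCA F (fun r s => lG r s) (fun r s => ipG r s) ca)
    (hF : ∀ x y : ↥F, ⁅(x : Derivation ℝ A A), (y : Derivation ℝ A A)⁆ ∈ F)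
    (ipG_nondeg : ∀ r, (∀ s, ipG r s = 0) → r = 0)
    (p q : Module.Dual A ↥F × G × ↥F) (z : ↥F) :
    (ca.dorf p q).1 z =
      sH F ca p.2.2 q.2.2 z
      + (fact F z (p.1 q.2.2) - fact F q.2.2 (p.1 z) + p.1 (fbk F hF q.2.2 z))
      + (fact F p.2.2 (q.1 z) - q.1 (fbk F hF p.2.2 z))
      + 2 * ipG q.2.1 (sNabla F ca z p.2.1)
      - 2 * ipG q.2.1 (sR F ca p.2.2 z) + 2 * ipG p.2.1 (sR F ca q.2.2 z) := by
  have fbk_zero : fbk F hF 0 z = 0 := Subtype.ext (by simp [fbk])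
  have fact_zero (f : A) : fact F 0 f = 0 := by simp [fact]
  conv_lhs => rw [prod_eq_add_add p]
  rw [map_add, map_add, LinearMap.add_apply, LinearMap.add_apply]
  simp only [Prod.fst_add, LinearMap.add_apply, h.dorf_covector_left_fst hF]
  conv_lhs => rw [prod_eq_add_add q]
  simp only [map_add, Prod.fst_add, Prod.snd_add, LinearMap.add_apply,
    h.dorf_covector_right_fst hF, h.dorf_section_section_fst ipG_nondeg,
    h.dorf_section_vector_fst, h.dorf_vector_section_fst, fbk_zero, fact_zero, map_zero,
    add_zero, zero_add]
  simp only [sH]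
  ring

section Isomorphism

variable {ca₁ ca₂ : CourantAlgebroid A (Module.Dual A ↥F × G × ↥F)}
variable {Θ : (Module.Dual A ↥F × G × ↥F) ≃ₗ[A] (Module.Dual A ↥F × G × ↥F)}

lemma iso_anchor (h₁ : IsStandardCA F (fun r s => lG r s) (fun r s => ipG r s) ca₁)
    (h₂ : IsStandardCA F (fun r s => lG r s) (fun r s => ipG r s) ca₂)
    (hρ : ∀ p, ca₂.rho (Θ p) = ca₁.rho p) (p : Module.Dual A ↥F × G × ↥F) :
    (Θ p).2.2 = p.2.2 := by
  apply Subtype.ext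
  rw [← h₂.1 (Θ p), hρ, h₁.1]

lemma iso_covector (h₁ : IsStandardCA F (fun r s => lG r s) (fun r s => ipG r s) ca₁)
    (h₂ : IsStandardCA F (fun r s => lG r s) (fun r s => ipG r s) ca₂)
    (hρ : ∀ p, ca₂.rho (Θ p) = ca₁.rho p)
    (hip : ∀ p q, ca₂.ip (Θ p) (Θ q) = ca₁.ip p q) (ξ : Module.Dual A ↥F) :
    Θ (ξ, 0, 0) = (ξ, 0, 0) := by
  apply ca₂.ip_nondeg.1
  refine LinearMap.ext fun q => ?_
  obtain ⟨p, rfl⟩ := Θ.surjective q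
  apply two_mul_cancel_of_real_algebra
  simp only [hip]
  rw [h₁.two_mul_ip, h₂.two_mul_ip, iso_anchor h₁ h₂ hρ p]
  simp

lemma iso_snd (h₁ : IsStandardCA F (fun r s => lG r s) (fun r s => ipG r s) ca₁)
    (h₂ : IsStandardCA F (fun r s => lG r s) (fun r s => ipG r s) ca₂)
    (hρ : ∀ p, ca₂.rho (Θ p) = ca₁.rho p)
    (hip : ∀ p q, ca₂.ip (Θ p) (Θ q) = ca₁.ip p q) (p : Module.Dual A ↥F × G × ↥F) :
    (Θ p).2.1 = (Θ (0, p.2.1, 0)).2.1 + (Θ (0, 0, p.2.2)).2.1 := by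
  conv_lhs => rw [prod_eq_add_add p]
  rw [map_add, map_add, iso_covector h₁ h₂ hρ hip]
  simp

lemma exists_iso_section (h₁ : IsStandardCA F (fun r s => lG r s) (fun r s => ipG r s) ca₁)
    (h₂ : IsStandardCA F (fun r s => lG r s) (fun r s => ipG r s) ca₂)
    (hρ : ∀ p, ca₂.rho (Θ p) = ca₁.rho p)
    (hip : ∀ p q, ca₂.ip (Θ p) (Θ q) = ca₁.ip p q) :
    ∃ τ : G ≃ₗ[A] G, ∀ r, τ r = (Θ (0, r, 0)).2.1 := by
  have hρ' (p) : ca₁.rho (Θ.symm p) = ca₂.rho p := by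
    rw [← hρ (Θ.symm p), Θ.apply_symm_apply]
  have hip' (p q) : ca₁.ip (Θ.symm p) (Θ.symm q) = ca₂.ip p q := by
    rw [← hip (Θ.symm p), Θ.apply_symm_apply, Θ.apply_symm_apply]
  let incl : G →ₗ[A] Module.Dual A ↥F × G × ↥F :=
    LinearMap.inr A _ _ ∘ₗ LinearMap.inl A _ _
  let proj : Module.Dual A ↥F × G × ↥F →ₗ[A] G := LinearMap.fst A _ _ ∘ₗ LinearMap.snd A _ _
  refine ⟨LinearEquiv.ofLinearMap (proj ∘ₗ Θ.toLinearMap ∘ₗ incl)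
    (proj ∘ₗ Θ.symm.toLinearMap ∘ₗ incl) ?_ ?_, fun r => rfl⟩
  · refine LinearMap.ext fun r => ?_
    have ha := iso_anchor h₂ h₁ hρ' (0, r, 0)
    have := iso_snd h₁ h₂ hρ hip (Θ.symm (0, r, 0))
    have h0 : Θ (0, 0, 0) = 0 := map_zero Θ
    rw [ha, Θ.apply_symm_apply, h0, Prod.snd_zero, Prod.fst_zero, add_zero] at this
    exact this.symm
  · refine LinearMap.ext fun r => ?_
    have ha := iso_anchor h₁ h₂ hρ (0, r, 0)
    have := iso_snd h₂ h₁ hρ' hip' (Θ (0, r, 0))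
    have h0 : Θ.symm (0, 0, 0) = 0 := map_zero Θ.symm
    rw [ha, Θ.symm_apply_apply, h0, Prod.snd_zero, Prod.fst_zero, add_zero] at this
    exact this.symm

end Isomorphism

end IsStandardCA

end NormalForm

open CourantAlgebroid in
/-- The normal form of isomorphisms of standard Courant algebroid
structures on `F*⊕𝒢⊕F`, together with the compatibility equations for
`(τ, φ, β)`. -/
theorem statement14
    {A : Type} [CommRing A] [Algebra ℝ A]
    (F : Submodule A (Derivation ℝ A A))
    (hF : ∀ x y : ↥F, ⁅(x : Derivation ℝ A A), (y : Derivation ℝ A A)⁆ ∈ F)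
    {G : Type} [AddCommGroup G] [Module A G] [Module ℝ G] [IsScalarTower ℝ A G]
    -- 𝒢 is a bundle of quadratic Lie algebras
    (lG : G →ₗ[A] G →ₗ[A] G) (ipG : G →ₗ[A] G →ₗ[A] A)
    (lG_skew : ∀ r s, lG r s = - lG s r)
    (lG_jacobi : ∀ r s t, lG r (lG s t) = lG (lG r s) t + lG s (lG r t))
    (ipG_symm : ∀ r s, ipG r s = ipG s r)
    (ipG_nondeg : ∀ r, (∀ s, ipG r s = 0) → r = 0)
    (ipG_ad : ∀ r s t, ipG (lG r s) t + ipG s (lG r t) = 0)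
    -- two standard Courant algebroid structures E^s₁, E^s₂ on F*⊕𝒢⊕F
    (ca₁ ca₂ : CourantAlgebroid A (Module.Dual A ↥F × G × ↥F))
    (hstd₁ : IsStandardCA F (fun r s => lG r s) (fun r s => ipG r s) ca₁)
    (hstd₂ : IsStandardCA F (fun r s => lG r s) (fun r s => ipG r s) ca₂)
    -- an isomorphism of Courant algebroids Θ : E^s₁ → E^s₂
    (Θ : (Module.Dual A ↥F × G × ↥F) ≃ₗ[A] (Module.Dual A ↥F × G × ↥F))
    (hΘ_rho : ∀ p, ca₂.rho (Θ p) = ca₁.rho p)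
    (hΘ_ip : ∀ p q, ca₂.ip (Θ p) (Θ q) = ca₁.ip p q)
    (hΘ_dorf : ∀ p q, Θ (ca₁.dorf p q) = ca₂.dorf (Θ p) (Θ q)) :
    ∃ (τ : G ≃ₗ[A] G) (φm : ↥F →ₗ[A] G) (β : ↥F →ₗ[A] Module.Dual A ↥F),
      -- τ is an automorphism of the bundle of quadratic Lie algebras 𝒢
      (∀ r s, τ (lG r s) = lG (τ r) (τ s)) ∧
      (∀ r s, ipG (τ r) (τ s) = ipG r s) ∧
      -- Θ(ξ+r+x) = (ξ + β(x) − 2φ*τ(r)) + (τ(r) + φ(x)) + x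
      (∀ p, (Θ p).2.2 = p.2.2) ∧
      (∀ p, (Θ p).2.1 = τ p.2.1 + φm p.2.2) ∧
      (∀ p (y : ↥F), (Θ p).1 y = p.1 y + β p.2.2 y - 2 * ipG (τ p.2.1) (φm y)) ∧
      -- (1) ½⟨β(x),y⟩ + ½⟨x,β(y)⟩ + ⟨φ(x),φ(y)⟩_𝒢 = 0
      (∀ x y : ↥F,
        (2:ℝ)⁻¹ • β x y + (2:ℝ)⁻¹ • β y x + ipG (φm x) (φm y) = 0) ∧
      -- (2) ∇²_x τ(r) − τ∇¹_x(r) = [τ(r),φ(x)]_𝒢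
      (∀ (x : ↥F) (r : G),
        sNabla F ca₂ x (τ r) - τ (sNabla F ca₁ x r) = lG (τ r) (φm x)) ∧
      -- (3) R²(x,y) − τR¹(x,y) = τ(∇¹_y τ⁻¹φ(x) − ∇¹_x τ⁻¹φ(y)) + φ[x,y] + [φ(x),φ(y)]_𝒢
      (∀ x y : ↥F,
        sR F ca₂ x y - τ (sR F ca₁ x y)
          = τ (sNabla F ca₁ y (τ.symm (φm x)) - sNabla F ca₁ x (τ.symm (φm y)))
            + φm (fbk F hF x y) + lG (φm x) (φm y)) ∧
      -- (4) ℋ²(x,y,z) − ℋ¹(x,y,z) + 2⟨φ(x),[φ(y),φ(z)]_𝒢⟩_𝒢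
      --     = (2⟨φ(x), τ∇¹_y τ⁻¹φ(z) − τR¹(y,z)⟩_𝒢 + L_x⟨y,β(z)⟩ + ⟨x,β[y,z]⟩) + c.p.
      (∀ x y z : ↥F,
        sH F ca₂ x y z - sH F ca₁ x y z + 2 * ipG (φm x) (lG (φm y) (φm z))
          = (2 * ipG (φm x) (τ (sNabla F ca₁ y (τ.symm (φm z))) - τ (sR F ca₁ y z))
              + fact F x (β z y) + β (fbk F hF y z) x)
            + (2 * ipG (φm y) (τ (sNabla F ca₁ z (τ.symm (φm x))) - τ (sR F ca₁ z x))
              + fact F y (β x z) + β (fbk F hF z x) y)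
            + (2 * ipG (φm z) (τ (sNabla F ca₁ x (τ.symm (φm y))) - τ (sR F ca₁ x y))
              + fact F z (β y x) + β (fbk F hF x y) z)) := by
  have hanchor := hstd₁.iso_anchor hstd₂ hΘ_rho
  have hcov := hstd₁.iso_covector hstd₂ hΘ_rho hΘ_ip
  have hsnd := hstd₁.iso_snd hstd₂ hΘ_rho hΘ_ip
  obtain ⟨τ, hτ⟩ := hstd₁.exists_iso_section hstd₂ hΘ_rho hΘ_ip
  obtain ⟨φm, hφ⟩ : ∃ φm : ↥F →ₗ[A] G, ∀ x, φm x = (Θ (0, 0, x)).2.1 :=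
    ⟨LinearMap.fst A _ _ ∘ₗ LinearMap.snd A _ _ ∘ₗ Θ.toLinearMap ∘ₗ LinearMap.inr A _ _ ∘ₗ
      LinearMap.inr A _ _, fun _ => rfl⟩
  obtain ⟨β, hβ⟩ : ∃ β : ↥F →ₗ[A] Module.Dual A ↥F, ∀ x, β x = (Θ (0, 0, x)).1 :=
    ⟨LinearMap.fst A _ _ ∘ₗ Θ.toLinearMap ∘ₗ LinearMap.inr A _ _ ∘ₗ LinearMap.inr A _ _,
      fun _ => rfl⟩
  have pairing (p q) : (Θ p).1 q.2.2 + (Θ q).1 p.2.2 + 2 * ipG (Θ p).2.1 (Θ q).2.1 =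
      p.1 q.2.2 + q.1 p.2.2 + 2 * ipG p.2.1 q.2.1 := by
    rw [← hstd₁.two_mul_ip, ← hΘ_ip, hstd₂.two_mul_ip, hanchor, hanchor]
  simp only [← hτ, ← hφ] at hsnd
  have hfst (p) (y : ↥F) : (Θ p).1 y = p.1 y + β p.2.2 y - 2 * ipG (τ p.2.1) (φm y) := by
    have hr := pairing (0, p.2.1, 0) (0, 0, y)
    simp only [← hτ, ← hφ, map_zero, LinearMap.zero_apply, mul_zero, add_zero] at hr
    conv_lhs => rw [prod_eq_add_add p]
    simp only [map_add, hcov, Prod.fst_add, LinearMap.add_apply, ← hβ]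
    linear_combination hr
  have hτ_ip (r s) : ipG (τ r) (τ s) = ipG r s := by
    apply two_mul_cancel_of_real_algebra
    simpa [hτ] using pairing (0, r, 0) (0, s, 0)
  have hβφ (x y : ↥F) : β x y + β y x + 2 * ipG (φm x) (φm y) = 0 := by
    simpa [← hβ, ← hφ] using pairing (0, 0, x) (0, 0, y)
  have fact_add (x : ↥F) (a b : A) : fact F x (a + b) = fact F x a + fact F x b :=
    map_add (x : Derivation ℝ A A) a b
  have hbr (p q) : τ (ca₁.dorf p q).2.1 + φm (ca₁.dorf p q).2.2 =
      (ca₂.dorf (Θ p) (Θ q)).2.1 := by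
    rw [← hΘ_dorf, hsnd]
  have sNabla_zero_left (r) : sNabla F ca₂ 0 r = 0 := by
    have h0 : ((0, 0, 0) : Module.Dual A ↥F × G × ↥F) = 0 := rfl
    simp [sNabla, h0]
  have sR_zero_left (y) : sR F ca₂ 0 y = 0 := by
    have h0 : ((0, 0, 0) : Module.Dual A ↥F × G × ↥F) = 0 := rfl
    simp [sR, h0]
  have sR_zero_right (y) : sR F ca₂ y 0 = 0 := by
    have h0 : ((0, 0, 0) : Module.Dual A ↥F × G × ↥F) = 0 := rfl
    simp [sR, h0]
  have hτ_lie (r s) : τ (lG r s) = lG (τ r) (τ s) := by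
    have := hbr (0, r, 0) (0, s, 0)
    rw [hstd₁.2.2, hstd₁.anchor_dorf_right_eq_zero _ rfl, hstd₂.dorf_snd ipG_nondeg] at this
    simpa [hsnd, hanchor, sNabla_zero_left, sR_zero_left] using this
  have hnabla (x : ↥F) (r : G) :
      sNabla F ca₂ x (τ r) - τ (sNabla F ca₁ x r) = lG (τ r) (φm x) := by
    have := hbr (0, 0, x) (0, r, 0)
    rw [hstd₁.anchor_dorf_right_eq_zero _ rfl, hstd₂.dorf_snd ipG_nondeg] at this
    simp only [hsnd, hanchor, sNabla_zero_left, sR_zero_right, map_zero, add_zero, zero_add,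
      sub_zero] at this
    rw [sNabla, sNabla] at *
    rw [this, lG_skew (τ r)]
    abel
  have hnabla' (x : ↥F) (r : G) :
      sNabla F ca₂ x r = τ (sNabla F ca₁ x (τ.symm r)) + lG r (φm x) := by
    have := hnabla x (τ.symm r)
    rw [τ.apply_symm_apply] at this
    rw [← this]
    abel
  have hR (x y : ↥F) : sR F ca₂ x y - τ (sR F ca₁ x y)
      = τ (sNabla F ca₁ y (τ.symm (φm x)) - sNabla F ca₁ x (τ.symm (φm y)))
        + φm (fbk F hF x y) + lG (φm x) (φm y) := by
    have := hbr (0, 0, x) (0, 0, y)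
    rw [hstd₁.anchor_dorf hF, hstd₂.dorf_snd ipG_nondeg] at this
    simp only [hsnd, hanchor, map_zero, zero_add, hnabla'] at this
    rw [lG_skew (φm y)] at this
    change τ (sR F ca₁ x y) + _ = _ at this
    rw [eq_sub_of_add_eq this, map_sub]
    abel
  refine ⟨τ, φm, β, hτ_lie, hτ_ip, hanchor, hsnd, hfst, ?_, hnabla, hR, ?_⟩
  · intro x y
    apply two_mul_cancel_of_real_algebra
    rw [mul_add, mul_add, two_mul_half_smul, two_mul_half_smul, hβφ, mul_zero]
  · intro x y z
    have key : (Θ (ca₁.dorf (0, 0, x) (0, 0, y))).1 z = _ :=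
      congrArg (fun e : Module.Dual A ↥F × G × ↥F => e.1 z) (hΘ_dorf (0, 0, x) (0, 0, y))
    rw [hfst, hstd₁.anchor_dorf hF, hstd₂.dorf_fst hF ipG_nondeg] at key
    simp only [hanchor, ← hβ, ← hφ] at key
    change sH F ca₁ x y z + _ - 2 * ipG (τ (sR F ca₁ x y)) _ = _ at key
    have fbk_skew : fbk F hF z x = -fbk F hF x z := Subtype.ext (lie_skew _ _).symm
    have fact_β (u v w : ↥F) : fact F u (β v w) + fact F u (β w v) +
        2 * (ipG (τ (sNabla F ca₁ u (τ.symm (φm v)))) (φm w) +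
          ipG (φm v) (τ (sNabla F ca₁ u (τ.symm (φm w))))) = 0 := by
      have hmetric : fact F u (ipG (φm v) (φm w)) =
          ipG (τ (sNabla F ca₁ u (τ.symm (φm v)))) (φm w) +
            ipG (φm v) (τ (sNabla F ca₁ u (τ.symm (φm w)))) := by
        have := hstd₁.fact_ipG u (τ.symm (φm v)) (τ.symm (φm w))
        rwa [← hτ_ip (τ.symm (φm v)), ← hτ_ip (sNabla F ca₁ u (τ.symm (φm v))),
          ← hτ_ip (τ.symm (φm v)) (sNabla F ca₁ u (τ.symm (φm w))), τ.apply_symm_apply,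
          τ.apply_symm_apply] at this
      rw [← hmetric, two_mul, ← fact_add, ← fact_add, ← fact_add, ← two_mul, hβφ]
      exact map_zero (u : Derivation ℝ A A)
    have hRxz := eq_add_of_sub_eq (hR x z)
    have hRyz := eq_add_of_sub_eq (hR y z)
    simp only [hRxz, hRyz, hnabla', map_add, map_sub, mul_add, mul_sub] at key
    have e1 := hβφ y (fbk F hF x z)
    have e2 := hβφ x (fbk F hF y z)
    rw [hstd₁.sR_skew ipG_nondeg z x, fbk_skew]
    simp only [map_neg, map_sub, LinearMap.neg_apply, mul_sub, mul_neg]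
    have e3 := fact_β x y z
    have e4 := fact_β z x y
    have s1 := ipG_symm (φm z) (τ (sNabla F ca₁ x (τ.symm (φm y))))
    have s2 := ipG_symm (φm y) (τ (sNabla F ca₁ z (τ.symm (φm x))))
    have s3 := ipG_symm (φm z) (τ (sR F ca₁ x y))
    linear_combination -key - e3 - e4 + e1 - e2 - 2 * s1 - 2 * s2 + 2 * s3
end
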